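/- (FAS lower bound) Suppose E satisfies (E1), and E together with all local energies E_i : V_i → ℝ (V_i closed subspaces of V, Q_i : V → V_i linear projections with Q_i w = w for w ∈ V_i) satisfies the approximation property (AP) with constant 0 < ε < μ/2. Let u^k = v₀ ∈ B and, for i = 1, …, N: ξ_i := Q_i v_{i−1}; η_i ∈ V_i solves ⟨E_i'(η_i), w⟩ = ⟨E_i'(ξ_i) − E'(v_{i−1}), w⟩ for all w ∈ V_i; s_i := η_i − ξ_i; v_i := v_{i−1} + s_i (step size 1); and u^{k+1} := v_N. Then E(u^k) − E(u^{k+1}) ≥ (μ/2 − ε) Σ_{i=1}^N ‖s_i‖². -/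

import Mathlib

theorem aux_mvt (g g' : ℝ → ℝ) (hg : ∀ t, HasDerivAt g (g' t) t) (c : ℝ)
    (h : ∀ t, t ∈ Set.Ioo (0:ℝ) 1 → g' t ≤ c) : g 1 - g 0 ≤ c := by
  obtain ⟨t, ht, he⟩ := exists_hasDerivAt_eq_slope g g' (zero_lt_one)
    (fun x _ => (hg x).continuousAt.continuousWithinAt) (fun x _ => hg x)
  have := h t ht
  rw [he] at this
  simpa using this

theorem aux_line {V : Type*} [NormedAddCommGroup V] [InnerProductSpace ℝ V] (w s : V) (t : ℝ) :
    HasDerivAt (fun t : ℝ => w + t • s) s t := by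
  simpa using ((hasDerivAt_id t).smul_const s).const_add w

theorem aux_conv {V : Type*} [NormedAddCommGroup V] [InnerProductSpace ℝ V]
    (E : V → ℝ) (E' : V → V →L[ℝ] ℝ)
    (hdiff : ∀ v : V, HasFDerivAt E (E' v) v) (μ : ℝ)
    (hE1 : ∀ v w : V, μ * ‖w - v‖ ^ 2 ≤ E' w (w - v) - E' v (w - v)) (w s : V) :
    E (w + s) - E w ≤ E' (w + s) s - μ / 2 * ‖s‖ ^ 2 := by
  have hd : ∀ t : ℝ, HasDerivAt (fun t : ℝ => E (w + t • s) + μ * ‖s‖ ^ 2 * (t - t ^ 2 / 2))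
      (E' (w + t • s) s + μ * ‖s‖ ^ 2 * (1 - t)) t := by
    intro t
    have h1 := (hdiff (w + t • s)).comp_hasDerivAt t (aux_line w s t)
    have h2 : HasDerivAt (fun t : ℝ => t - t ^ 2 / 2) (1 - t) t := by
      have := (hasDerivAt_id t).sub (((hasDerivAt_id t).pow 2).div_const 2)
      exact this.congr_deriv (by simp)
    exact h1.add (h2.const_mul _)
  have := aux_mvt _ _ hd (E' (w + s) s) (by
    rintro t ⟨_, ht⟩
    have h := hE1 (w + t • s) (w + s)
    have e : w + s - (w + t • s) = (1 - t) • s := by module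
    have hp : 0 < 1 - t := by linarith
    rw [e, norm_smul, map_smul, map_smul, Real.norm_of_nonneg hp.le, smul_eq_mul,
      smul_eq_mul] at h
    have h3 : (1 - t) * (μ * ‖s‖ ^ 2 * (1 - t)) ≤ (1 - t) * (E' (w + s) s - E' (w + t • s) s) := by
      linarith
    have := le_of_mul_le_mul_left h3 hp
    linarith)
  simp only [one_smul, zero_smul, add_zero] at this
  linarith

/-- FAS lower bound: under (E1) and the approximation property (AP) with
constant 0 < ε < μ/2, one iteration of the original FAS scheme (step size 1) decreases the
energy by at least (μ/2 − ε) Σ ‖s_i‖². -/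
theorem stmt_19
    {V : Type*} [NormedAddCommGroup V] [InnerProductSpace ℝ V] [CompleteSpace V]
    (E : V → ℝ) (E' : V → V →L[ℝ] ℝ) (E'' : V → V →L[ℝ] V →L[ℝ] ℝ)
    (hdiff : ∀ v : V, HasFDerivAt E (E' v) v)
    (hdiff2 : ∀ v : V, HasFDerivAt E' (E'' v) v)
    (μ : ℝ) (hμ : 0 < μ) (u₀ : V)
    (hE1 : ∀ v w : V, μ * ‖w - v‖ ^ 2 ≤ E' w (w - v) - E' v (w - v))
    (N : ℕ) (Vsub : Fin N → Submodule ℝ V)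
    (hclosed : ∀ i, IsClosed ((Vsub i : Set V)))
    (Q : Fin N → V →ₗ[ℝ] V)
    (hQmem : ∀ i x, Q i x ∈ Vsub i)
    (hQproj : ∀ i, ∀ x ∈ Vsub i, Q i x = x)
    (Ei : Fin N → V → ℝ) (Ei' : Fin N → V → V →L[ℝ] ℝ)
    (Ei'' : Fin N → V → V →L[ℝ] V →L[ℝ] ℝ)
    (hEid1 : ∀ i, ∀ x ∈ (Vsub i : Set V),
      HasFDerivWithinAt (Ei i) (Ei' i x) (Vsub i : Set V) x)
    (hEid2 : ∀ i, ∀ x ∈ (Vsub i : Set V),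
      HasFDerivWithinAt (Ei' i) (Ei'' i x) (Vsub i : Set V) x)
    (ε : ℝ) (hε0 : 0 < ε) (hεμ : ε < μ / 2)
    (hAP : ∀ i, ∀ w, E w ≤ E u₀ → ∀ ηv ∈ Vsub i, ∀ uu ∈ Vsub i, ∀ vv ∈ Vsub i,
      |E'' (w + ηv) uu vv - Ei'' i (Q i w + ηv) uu vv| ≤ ε * ‖uu‖ * ‖vv‖)
    (v : Fin (N + 1) → V) (hv0 : E (v 0) ≤ E u₀)
    (ξ η s : Fin N → V)
    (hξ : ∀ i, ξ i = Q i (v i.castSucc))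
    (hηmem : ∀ i, η i ∈ Vsub i)
    (hres : ∀ i, ∀ w ∈ Vsub i,
      Ei' i (η i) w = Ei' i (ξ i) w - E' (v i.castSucc) w)
    (hs : ∀ i, s i = η i - ξ i)
    (hstep : ∀ i, v i.succ = v i.castSucc + s i) :
    (μ / 2 - ε) * ∑ i, ‖s i‖ ^ 2 ≤ E (v 0) - E (v (Fin.last N)) := by
  have step : ∀ i : Fin N, E (v i.castSucc) ≤ E u₀ →
      (μ / 2 - ε) * ‖s i‖ ^ 2 ≤ E (v i.castSucc) - E (v i.succ) := by
    intro i hB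
    have hξm : ξ i ∈ Vsub i := by rw [hξ]; exact hQmem _ _
    have hsm : s i ∈ Vsub i := by rw [hs]; exact (Vsub i).sub_mem (hηmem i) hξm
    have hd : ∀ t : ℝ, HasDerivAt
        (fun t : ℝ => E' (v i.castSucc + t • s i) (s i) - Ei' i (ξ i + t • s i) (s i))
        (E'' (v i.castSucc + t • s i) (s i) (s i) - Ei'' i (ξ i + t • s i) (s i) (s i)) t := by
      intro t
      have hm : ∀ t : ℝ, ξ i + t • s i ∈ (Vsub i : Set V) := fun t =>
        (Vsub i).add_mem hξm ((Vsub i).smul_mem t hsm)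
      have h1 := (hdiff2 (v i.castSucc + t • s i)).comp_hasDerivAt t (aux_line _ (s i) t)
      have h2 := (hEid2 i _ (hm t)).comp_hasDerivAt t (aux_line _ (s i) t)
        (Filter.Eventually.of_forall hm)
      have h3 := (ContinuousLinearMap.apply ℝ ℝ (s i)).hasFDerivAt.comp_hasDerivAt t h1
      have h4 := (ContinuousLinearMap.apply ℝ ℝ (s i)).hasFDerivAt.comp_hasDerivAt t h2
      exact h3.sub h4
    have h := aux_mvt _ _ hd (ε * ‖s i‖ * ‖s i‖) (by
      intro t _
      have := hAP i _ hB (t • s i) ((Vsub i).smul_mem t hsm) _ hsm _ hsm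
      rw [← hξ] at this
      exact (le_abs_self _).trans this)
    simp only [one_smul, zero_smul, add_zero] at h
    have e : ξ i + s i = η i := by rw [hs]; abel
    rw [e, hres i _ hsm] at h
    have hc := aux_conv E E' hdiff μ hE1 (v i.castSucc) (s i)
    rw [hstep]
    nlinarith
  have hdec : ∀ j : Fin (N + 1), E (v j) ≤ E u₀ := by
    intro j
    induction j using Fin.induction with
    | zero => exact hv0
    | succ i ih =>
      have := step i ih
      have : 0 ≤ (μ / 2 - ε) * ‖s i‖ ^ 2 := mul_nonneg (by linarith) (sq_nonneg _)
      linarith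
  have tel : ∀ (n : ℕ) (f : Fin (n + 1) → ℝ),
      ∑ i : Fin n, (f i.castSucc - f i.succ) = f 0 - f (Fin.last n) := by
    intro n f
    have h1 := Fin.sum_univ_succ f
    have h2 := Fin.sum_univ_castSucc f
    rw [Finset.sum_sub_distrib]
    linarith
  rw [Finset.mul_sum, ← tel N (fun j => E (v j))]
  exact Finset.sum_le_sum fun i _ => step i (hdec _)
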